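/- Every element of the third exterior power of ℂ⁷ is a sum of at most 4 decomposable trivectors: for every x : ⋀[ℂ]^3 (Fin 7 → ℂ) there exist vectors v_{i,j} : Fin 7 → ℂ for i : Fin 4, j : Fin 3 such that x = ∑_{i : Fin 4} v_{i,0} ∧ v_{i,1} ∧ v_{i,2}, where v₀ ∧ v₁ ∧ v₂ denotes the image of the alternating multilinear map ιMulti applied to the triple (v₀, v₁, v₂). -/

import Mathlib

namespace Trivector

variable {K V M : Type*} [Field K] [AddCommGroup V] [Module K V] [AddCommGroup M] [Module K M]

/-- The value of an alternating trilinear map on three vectors. -/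
def tri (w : V [⋀^Fin 3]→ₗ[K] M) (p q r : V) : M := w ![p, q, r]

section tri

variable (w : V [⋀^Fin 3]→ₗ[K] M) (p p' q r : V) (c : K)

lemma tri_rotate : tri w p q r = tri w q r p := by
  have h : (![q, r, p] : Fin 3 → V) = ![p, q, r] ∘ finRotate 3 := by
    ext i; fin_cases i <;> rfl
  rw [tri, tri, h, w.map_perm, sign_finRotate]
  simp

lemma tri_add_left : tri w (p + p') q r = tri w p q r + tri w p' q r := by
  have h (x : V) : Function.update ![p, q, r] 0 x = ![x, q, r] := by
    ext i; fin_cases i <;> rfl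
  simpa only [h, tri] using w.map_update_add ![p, q, r] 0 p p'

lemma tri_smul_left : tri w (c • p) q r = c • tri w p q r := by
  have h (x : V) : Function.update ![p, q, r] 0 x = ![x, q, r] := by
    ext i; fin_cases i <;> rfl
  simpa only [h, tri] using w.map_update_smul ![p, q, r] 0 c p

lemma tri_add_mid : tri w q (p + p') r = tri w q p r + tri w q p' r := by
  simp only [tri_rotate w q, tri_add_left]

lemma tri_add_right : tri w q r (p + p') = tri w q r p + tri w q r p' := by
  simp only [← tri_rotate w _ q, tri_add_left]

lemma tri_smul_mid : tri w q (c • p) r = c • tri w q p r := by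
  simp only [tri_rotate w q, tri_smul_left]

lemma tri_smul_right : tri w q r (c • p) = c • tri w q r p := by
  simp only [← tri_rotate w _ q, tri_smul_left]

lemma tri_zero_left : tri w 0 q r = 0 := by
  simpa using tri_smul_left w 0 q r (0 : K)

lemma tri_zero_mid : tri w q 0 r = 0 := by
  rw [tri_rotate, tri_zero_left]

lemma tri_zero_right : tri w q r 0 = 0 := by
  rw [← tri_rotate, tri_zero_left]

lemma tri_self_left : tri w p p q = 0 :=
  w.map_eq_zero_of_eq ![p, p, q] (i := 0) (j := 1) rfl (by decide)

lemma tri_self_right : tri w q p p = 0 := by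
  rw [tri_rotate, tri_self_left]

lemma tri_self_outer : tri w p q p = 0 := by
  rw [tri_rotate, tri_self_right]

lemma tri_swap_left : tri w p q r = -tri w q p r := by
  have h := tri_self_left w (p + q) r
  rw [tri_add_left, tri_add_mid, tri_add_mid, tri_self_left, tri_self_left, zero_add, add_zero] at h
  exact eq_neg_of_add_eq_zero_left h

lemma tri_swap_right : tri w p q r = -tri w p r q := by
  rw [tri_rotate, tri_swap_left, tri_rotate, tri_rotate]

lemma tri_neg_left : tri w (-p) q r = -tri w p q r := by
  simpa using tri_smul_left w p q r (-1 : K)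

lemma tri_neg_mid : tri w q (-p) r = -tri w q p r := by
  simpa using tri_smul_mid w p q r (-1 : K)

lemma tri_neg_right : tri w q r (-p) = -tri w q r p := by
  simpa using tri_smul_right w p q r (-1 : K)

lemma tri_sub_left : tri w (p - p') q r = tri w p q r - tri w p' q r := by
  simp only [sub_eq_add_neg, tri_add_left, tri_neg_left]

lemma tri_sub_mid : tri w q (p - p') r = tri w q p r - tri w q p' r := by
  simp only [sub_eq_add_neg, tri_add_mid, tri_neg_mid]

lemma tri_sub_right : tri w q r (p - p') = tri w q r p - tri w q r p' := by
  simp only [sub_eq_add_neg, tri_add_right, tri_neg_right]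

lemma tri_sort_left {n : ℕ} (v : Fin n → V) {i j : Fin n} (_ : j < i) :
    tri w (v i) (v j) r = -tri w (v j) (v i) r :=
  tri_swap_left w _ _ r

lemma tri_sort_right {n : ℕ} (v : Fin n → V) {i j : Fin n} (_ : j < i) :
    tri w r (v i) (v j) = -tri w r (v j) (v i) :=
  tri_swap_right w r _ _

end tri

attribute [simp] tri_add_left tri_add_mid tri_add_right tri_smul_left tri_smul_mid tri_smul_right
  tri_zero_left tri_zero_mid tri_zero_right tri_self_left tri_self_right tri_self_outer
  tri_neg_left tri_neg_mid tri_neg_right tri_sub_left tri_sub_mid tri_sub_right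

/-- `x` is a sum of at most four values of `w`. -/
def RankLEFour (w : V [⋀^Fin 3]→ₗ[K] M) (x : M) : Prop :=
  ∃ v : Fin 4 → Fin 3 → V, x = ∑ i, w (v i)

lemma rankLEFour_of_eq {w : V [⋀^Fin 3]→ₗ[K] M} {x : M}
    (p₁ q₁ r₁ p₂ q₂ r₂ p₃ q₃ r₃ p₄ q₄ r₄ : V)
    (h : x = tri w p₁ q₁ r₁ + tri w p₂ q₂ r₂ + tri w p₃ q₃ r₃ + tri w p₄ q₄ r₄) :
    RankLEFour w x :=
  ⟨![![p₁, q₁, r₁], ![p₂, q₂, r₂], ![p₃, q₃, r₃], ![p₄, q₄, r₄]], by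
    simpa [Fin.sum_univ_succ, tri, add_assoc] using h⟩

/-- Seven vectors as the values of a family. -/
lemma exists_family {V : Type*} (p₀ p₁ p₂ p₃ p₄ p₅ p₆ : V) :
    ∃ v : Fin 7 → V, v 0 = p₀ ∧ v 1 = p₁ ∧ v 2 = p₂ ∧
    v 3 = p₃ ∧ v 4 = p₄ ∧ v 5 = p₅ ∧ v 6 = p₆ :=
  ⟨![p₀, p₁, p₂, p₃, p₄, p₅, p₆], rfl, rfl, rfl, rfl, rfl, rfl, rfl⟩

lemma rankLEFour_of_pivot (w : V [⋀^Fin 3]→ₗ[K] M) (e a₁ a₂ a₃ b₁ b₂ b₃ : V)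
    (α₁ α₂ α₃ β₁ β₂ β₃ m₁₁ m₁₂ m₁₃ m₂₁ m₂₂ m₂₃ m₃₁ m₃₂ m₃₃ : K) (h : m₁₁ ≠ 0) :
    RankLEFour w (tri w a₁ a₂ a₃ + tri w b₁ b₂ b₃
      + (α₁ • tri w e a₂ a₃ + α₂ • tri w e a₃ a₁ + α₃ • tri w e a₁ a₂)
      + (β₁ • tri w e b₂ b₃ + β₂ • tri w e b₃ b₁ + β₃ • tri w e b₁ b₂)
      + (m₁₁ • tri w e a₁ b₁ + m₁₂ • tri w e a₁ b₂ + m₁₃ • tri w e a₁ b₃)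
      + (m₂₁ • tri w e a₂ b₁ + m₂₂ • tri w e a₂ b₂ + m₂₃ • tri w e a₂ b₃)
      + (m₃₁ • tri w e a₃ b₁ + m₃₂ • tri w e a₃ b₂ + m₃₃ • tri w e a₃ b₃)) := by
  obtain ⟨v, rfl, rfl, rfl, rfl, rfl, rfl, rfl⟩ := exists_family e a₁ a₂ a₃ b₁ b₂ b₃
  obtain ⟨k, hk⟩ : ∃ k, m₁₁ * k = 1 := ⟨m₁₁⁻¹, mul_inv_cancel₀ h⟩
  obtain ⟨x, rfl⟩ : ∃ x, m₂₁ = x * m₁₁ := ⟨m₂₁ * k, by linear_combination -m₂₁ * hk⟩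
  obtain ⟨y, rfl⟩ : ∃ x, m₃₁ = x * m₁₁ := ⟨m₃₁ * k, by linear_combination -m₃₁ * hk⟩
  set n₂₂ := m₂₂ - x * m₁₂ with hn₂₂
  set n₂₃ := m₂₃ - x * m₁₃ with hn₂₃
  set n₃₂ := m₃₂ - y * m₁₂ with hn₃₂
  set n₃₃ := m₃₃ - y * m₁₃ with hn₃₃
  refine rankLEFour_of_eq (v 0) (v 1 + x • v 2 + y • v 3) (m₁₁ • v 4 + m₁₂ • v 5 + m₁₃ • v 6)
    (v 0) (v 2 - n₃₂ • v 5 - n₃₃ • v 6) (v 3 + n₂₂ • v 5 + n₂₃ • v 6)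
    (v 1 + (α₁ - 1) • v 0) (v 2 + α₂ • v 0) (v 3 + α₃ • v 0)
    (v 4 + (β₁ - (n₂₂ * n₃₃ - n₂₃ * n₃₂)) • v 0) (v 5 + β₂ • v 0) (v 6 + β₃ • v 0) ?_
  simp [tri_sort_left w _ v, tri_sort_right w _ v]
  module

lemma rankLEFour_of_column (w : V [⋀^Fin 3]→ₗ[K] M) (e a₁ a₂ a₃ b₁ b₂ b₃ : V)
    (α₁ α₂ α₃ β₁ β₂ β₃ m₁₁ m₁₂ m₁₃ m₂₁ m₂₂ m₂₃ m₃₁ m₃₂ m₃₃ : K)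
    (h : m₁₁ ≠ 0 ∨ m₂₁ ≠ 0 ∨ m₃₁ ≠ 0) :
    RankLEFour w (tri w a₁ a₂ a₃ + tri w b₁ b₂ b₃
      + (α₁ • tri w e a₂ a₃ + α₂ • tri w e a₃ a₁ + α₃ • tri w e a₁ a₂)
      + (β₁ • tri w e b₂ b₃ + β₂ • tri w e b₃ b₁ + β₃ • tri w e b₁ b₂)
      + (m₁₁ • tri w e a₁ b₁ + m₁₂ • tri w e a₁ b₂ + m₁₃ • tri w e a₁ b₃)
      + (m₂₁ • tri w e a₂ b₁ + m₂₂ • tri w e a₂ b₂ + m₂₃ • tri w e a₂ b₃)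
      + (m₃₁ • tri w e a₃ b₁ + m₃₂ • tri w e a₃ b₂ + m₃₃ • tri w e a₃ b₃)) := by
  rcases h with h | h | h
  · exact rankLEFour_of_pivot w e a₁ a₂ a₃ b₁ b₂ b₃ _ _ _ _ _ _ _ _ _ _ _ _ _ _ _ h
  · convert rankLEFour_of_pivot w e a₂ a₃ a₁ b₁ b₂ b₃ α₂ α₃ α₁ β₁ β₂ β₃ m₂₁ m₂₂ m₂₃ m₃₁ m₃₂ m₃₃
      m₁₁ m₁₂ m₁₃ h using 1
    rw [tri_rotate w a₁ a₂ a₃]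
    abel
  · convert rankLEFour_of_pivot w e a₃ a₁ a₂ b₁ b₂ b₃ α₃ α₁ α₂ β₁ β₂ β₃ m₃₁ m₃₂ m₃₃
      m₁₁ m₁₂ m₁₃ m₂₁ m₂₂ m₂₃ h using 1
    rw [tri_rotate w a₃ a₁ a₂]
    abel

lemma rankLEFour_of_coeffs (w : V [⋀^Fin 3]→ₗ[K] M) (e a₁ a₂ a₃ b₁ b₂ b₃ : V)
    (α₁ α₂ α₃ β₁ β₂ β₃ m₁₁ m₁₂ m₁₃ m₂₁ m₂₂ m₂₃ m₃₁ m₃₂ m₃₃ : K) :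
    RankLEFour w (tri w a₁ a₂ a₃ + tri w b₁ b₂ b₃
      + (α₁ • tri w e a₂ a₃ + α₂ • tri w e a₃ a₁ + α₃ • tri w e a₁ a₂)
      + (β₁ • tri w e b₂ b₃ + β₂ • tri w e b₃ b₁ + β₃ • tri w e b₁ b₂)
      + (m₁₁ • tri w e a₁ b₁ + m₁₂ • tri w e a₁ b₂ + m₁₃ • tri w e a₁ b₃)
      + (m₂₁ • tri w e a₂ b₁ + m₂₂ • tri w e a₂ b₂ + m₂₃ • tri w e a₂ b₃)
      + (m₃₁ • tri w e a₃ b₁ + m₃₂ • tri w e a₃ b₂ + m₃₃ • tri w e a₃ b₃)) := by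
  by_cases h₁ : m₁₁ ≠ 0 ∨ m₂₁ ≠ 0 ∨ m₃₁ ≠ 0
  · exact rankLEFour_of_column w e a₁ a₂ a₃ b₁ b₂ b₃ _ _ _ _ _ _ _ _ _ _ _ _ _ _ _ h₁
  by_cases h₂ : m₁₂ ≠ 0 ∨ m₂₂ ≠ 0 ∨ m₃₂ ≠ 0
  · convert rankLEFour_of_column w e a₁ a₂ a₃ b₂ b₃ b₁ α₁ α₂ α₃ β₂ β₃ β₁ m₁₂ m₁₃ m₁₁ m₂₂ m₂₃ m₂₁
      m₃₂ m₃₃ m₃₁ h₂ using 1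
    rw [tri_rotate w b₁ b₂ b₃]
    abel
  by_cases h₃ : m₁₃ ≠ 0 ∨ m₂₃ ≠ 0 ∨ m₃₃ ≠ 0
  · convert rankLEFour_of_column w e a₁ a₂ a₃ b₃ b₁ b₂ α₁ α₂ α₃ β₃ β₁ β₂ m₁₃ m₁₁ m₁₂ m₂₃ m₂₁ m₂₂
      m₃₃ m₃₁ m₃₂ h₃ using 1
    rw [tri_rotate w b₃ b₁ b₂]
    abel
  push Not at h₁ h₂ h₃
  obtain ⟨rfl, rfl, rfl⟩ := h₁
  obtain ⟨rfl, rfl, rfl⟩ := h₂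
  obtain ⟨rfl, rfl, rfl⟩ := h₃
  obtain ⟨v, rfl, rfl, rfl, rfl, rfl, rfl, rfl⟩ := exists_family e a₁ a₂ a₃ b₁ b₂ b₃
  refine rankLEFour_of_eq (v 1 + α₁ • v 0) (v 2 + α₂ • v 0) (v 3 + α₃ • v 0)
    (v 4 + β₁ • v 0) (v 5 + β₂ • v 0) (v 6 + β₃ • v 0) 0 0 0 0 0 0 ?_
  simp [tri_sort_left w _ v, tri_sort_right w _ v]
  module

/-- The trivectors divisible by `e`. -/
def divisible (w : V [⋀^Fin 3]→ₗ[K] M) (e : V) : Submodule K M :=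
  Submodule.span K {x | ∃ p q, x = tri w e p q}

lemma tri_mem_divisible (w : V [⋀^Fin 3]→ₗ[K] M) (e p q : V) : tri w e p q ∈ divisible w e :=
  Submodule.subset_span ⟨p, q, rfl⟩

/-- The seven given vectors span the whole space. -/
def Spans (K : Type*) {V : Type*} [Field K] [AddCommGroup V] [Module K V]
    (p₀ p₁ p₂ p₃ p₄ p₅ p₆ : V) : Prop :=
  ∀ S : Submodule K V, p₀ ∈ S → p₁ ∈ S → p₂ ∈ S → p₃ ∈ S → p₄ ∈ S → p₅ ∈ S → p₆ ∈ S → S = ⊤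

lemma Spans.exists_coords {p₀ p₁ p₂ p₃ p₄ p₅ p₆ : V} (h : Spans K p₀ p₁ p₂ p₃ p₄ p₅ p₆) (p : V) :
    ∃ c : Fin 7 → K, p = c 0 • p₀ + c 1 • p₁ + c 2 • p₂ + c 3 • p₃ + c 4 • p₄ + c 5 • p₅
      + c 6 • p₆ := by
  obtain ⟨v, rfl, rfl, rfl, rfl, rfl, rfl, rfl⟩ := exists_family p₀ p₁ p₂ p₃ p₄ p₅ p₆
  have hv (i : Fin 7) : v i ∈ Submodule.span K (Set.range v) := Submodule.subset_span ⟨i, rfl⟩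
  have hp : p ∈ Submodule.span K (Set.range v) := by
    rw [h _ (hv 0) (hv 1) (hv 2) (hv 3) (hv 4) (hv 5) (hv 6)]
    trivial
  obtain ⟨c, rfl⟩ := (Submodule.mem_span_range_iff_exists_fun K).1 hp
  exact ⟨c, by simp [Fin.sum_univ_seven]⟩

lemma Spans.exists_coeffs_of_mem_divisible {w : V [⋀^Fin 3]→ₗ[K] M} {e a₁ a₂ a₃ b₁ b₂ b₃ : V}
    (h : Spans K e a₁ a₂ a₃ b₁ b₂ b₃) {x : M} (hx : x ∈ divisible w e) :
    ∃ α₁ α₂ α₃ β₁ β₂ β₃ m₁₁ m₁₂ m₁₃ m₂₁ m₂₂ m₂₃ m₃₁ m₃₂ m₃₃ : K, x =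
      (α₁ • tri w e a₂ a₃ + α₂ • tri w e a₃ a₁ + α₃ • tri w e a₁ a₂)
      + (β₁ • tri w e b₂ b₃ + β₂ • tri w e b₃ b₁ + β₃ • tri w e b₁ b₂)
      + (m₁₁ • tri w e a₁ b₁ + m₁₂ • tri w e a₁ b₂ + m₁₃ • tri w e a₁ b₃)
      + (m₂₁ • tri w e a₂ b₁ + m₂₂ • tri w e a₂ b₂ + m₂₃ • tri w e a₂ b₃)
      + (m₃₁ • tri w e a₃ b₁ + m₃₂ • tri w e a₃ b₂ + m₃₃ • tri w e a₃ b₃) := by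
  induction hx using Submodule.span_induction with
  | mem x hx =>
    obtain ⟨p, q, rfl⟩ := hx
    obtain ⟨s, rfl⟩ := h.exists_coords p
    obtain ⟨t, rfl⟩ := h.exists_coords q
    obtain ⟨v, rfl, rfl, rfl, rfl, rfl, rfl, rfl⟩ := exists_family e a₁ a₂ a₃ b₁ b₂ b₃
    refine ⟨s 2 * t 3 - s 3 * t 2, s 3 * t 1 - s 1 * t 3, s 1 * t 2 - s 2 * t 1,
      s 5 * t 6 - s 6 * t 5, s 6 * t 4 - s 4 * t 6, s 4 * t 5 - s 5 * t 4,
      s 1 * t 4 - s 4 * t 1, s 1 * t 5 - s 5 * t 1, s 1 * t 6 - s 6 * t 1,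
      s 2 * t 4 - s 4 * t 2, s 2 * t 5 - s 5 * t 2, s 2 * t 6 - s 6 * t 2,
      s 3 * t 4 - s 4 * t 3, s 3 * t 5 - s 5 * t 3, s 3 * t 6 - s 6 * t 3, ?_⟩
    simp [tri_sort_right w _ v]
    module
  | zero => exact ⟨0, 0, 0, 0, 0, 0, 0, 0, 0, 0, 0, 0, 0, 0, 0, by simp⟩
  | add x y _ _ hx hy =>
    obtain ⟨α₁, α₂, α₃, β₁, β₂, β₃, m₁₁, m₁₂, m₁₃, m₂₁, m₂₂, m₂₃, m₃₁, m₃₂, m₃₃, rfl⟩ := hx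
    obtain ⟨γ₁, γ₂, γ₃, δ₁, δ₂, δ₃, n₁₁, n₁₂, n₁₃, n₂₁, n₂₂, n₂₃, n₃₁, n₃₂, n₃₃, rfl⟩ := hy
    exact ⟨α₁ + γ₁, α₂ + γ₂, α₃ + γ₃, β₁ + δ₁, β₂ + δ₂, β₃ + δ₃, m₁₁ + n₁₁, m₁₂ + n₁₂, m₁₃ + n₁₃,
      m₂₁ + n₂₁, m₂₂ + n₂₂, m₂₃ + n₂₃, m₃₁ + n₃₁, m₃₂ + n₃₂, m₃₃ + n₃₃, by module⟩
  | smul k x _ hx =>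
    obtain ⟨α₁, α₂, α₃, β₁, β₂, β₃, m₁₁, m₁₂, m₁₃, m₂₁, m₂₂, m₂₃, m₃₁, m₃₂, m₃₃, rfl⟩ := hx
    exact ⟨k * α₁, k * α₂, k * α₃, k * β₁, k * β₂, k * β₃, k * m₁₁, k * m₁₂, k * m₁₃,
      k * m₂₁, k * m₂₂, k * m₂₃, k * m₃₁, k * m₃₂, k * m₃₃, by module⟩

/-- A trivector congruent to a sum of two decomposable ones modulo `e`, in general position. -/
lemma Spans.rankLEFour_of_split {w : V [⋀^Fin 3]→ₗ[K] M} {e a₁ a₂ a₃ b₁ b₂ b₃ : V}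
    (h : Spans K e a₁ a₂ a₃ b₁ b₂ b₃) {x : M}
    (hx : x - (tri w a₁ a₂ a₃ + tri w b₁ b₂ b₃) ∈ divisible w e) : RankLEFour w x := by
  obtain ⟨α₁, α₂, α₃, β₁, β₂, β₃, m₁₁, m₁₂, m₁₃, m₂₁, m₂₂, m₂₃, m₃₁, m₃₂, m₃₃, hx⟩ :=
    h.exists_coeffs_of_mem_divisible hx
  rw [sub_eq_iff_eq_add'] at hx
  convert rankLEFour_of_coeffs w e a₁ a₂ a₃ b₁ b₂ b₃ α₁ α₂ α₃ β₁ β₂ β₃ m₁₁ m₁₂ m₁₃ m₂₁ m₂₂ m₂₃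
    m₃₁ m₃₂ m₃₃ using 1
  rw [hx]
  abel

lemma mkQ_tri (w : V [⋀^Fin 3]→ₗ[K] M) (S : Submodule K M) (p q r : V) :
    S.mkQ (tri w p q r) = tri (S.mkQ.compAlternatingMap w) p q r := rfl

section mkQ

variable (w : V [⋀^Fin 3]→ₗ[K] M) (e p q : V)

@[simp]
lemma tri_mkQ_divisible_left :
    tri ((divisible w e).mkQ.compAlternatingMap w) e p q = 0 := by
  rw [← mkQ_tri, Submodule.mkQ_apply, Submodule.Quotient.mk_eq_zero]
  exact tri_mem_divisible w e p q

@[simp]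
lemma tri_mkQ_divisible_mid :
    tri ((divisible w e).mkQ.compAlternatingMap w) p e q = 0 := by
  rw [tri_rotate, tri_mkQ_divisible_left]

@[simp]
lemma tri_mkQ_divisible_right :
    tri ((divisible w e).mkQ.compAlternatingMap w) p q e = 0 := by
  rw [← tri_rotate, tri_mkQ_divisible_left]

lemma mem_iff_mkQ_eq_zero (S : Submodule K M) (x : M) : x ∈ S ↔ S.mkQ x = 0 := by
  rw [Submodule.mkQ_apply, Submodule.Quotient.mk_eq_zero]

end mkQ

/-- A bivector in three variables is decomposable. -/
lemma exists_normal_form_three (w : V [⋀^Fin 3]→ₗ[K] M) (a u₁ u₂ u₃ : V) (c₁₂ c₁₃ c₂₃ : K) :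
    ∃ (z₁ z₂ z₃ : V) (k : K),
      (∀ S : Submodule K V, z₁ ∈ S → z₂ ∈ S → z₃ ∈ S → u₁ ∈ S ∧ u₂ ∈ S ∧ u₃ ∈ S) ∧
      c₁₂ • tri w a u₁ u₂ + c₁₃ • tri w a u₁ u₃ + c₂₃ • tri w a u₂ u₃ = k • tri w a z₁ z₂ := by
  by_cases h₁ : c₁₂ = 0
  · by_cases h₂ : c₁₃ = 0
    · exact ⟨u₂, u₃, u₁, c₂₃, fun S h₂ h₃ h₁ ↦ ⟨h₁, h₂, h₃⟩, by simp [h₁, h₂]⟩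
    · obtain ⟨x, rfl⟩ : ∃ x, c₂₃ = c₁₃ * x := ⟨c₁₃⁻¹ * c₂₃, by field_simp⟩
      refine ⟨u₁ + x • u₂, u₃, u₂, c₁₃, fun S h₁ h₃ h₂ ↦ ⟨?_, h₂, h₃⟩, ?_⟩
      · simpa using S.sub_mem h₁ (S.smul_mem x h₂)
      · simp only [h₁, tri_add_mid, tri_smul_mid]
        module
  · obtain ⟨x, rfl⟩ : ∃ x, c₁₃ = c₁₂ * x := ⟨c₁₂⁻¹ * c₁₃, by field_simp⟩
    obtain ⟨y, rfl⟩ : ∃ y, c₂₃ = c₁₂ * y := ⟨c₁₂⁻¹ * c₂₃, by field_simp⟩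
    refine ⟨u₁ - y • u₃, u₂ + x • u₃, u₃, c₁₂, fun S h₁ h₂ h₃ ↦ ⟨?_, ?_, h₃⟩, ?_⟩
    · simpa using S.add_mem h₁ (S.smul_mem y h₃)
    · simpa using S.sub_mem h₂ (S.smul_mem x h₃)
    · simp [tri_swap_right w a u₃ u₂]
      module

lemma exists_normal_form_of_pivot (w : V [⋀^Fin 3]→ₗ[K] M) (a : V) (u : Fin 5 → V)
    (c : Fin 5 → Fin 5 → K) (h : c 0 1 - c 1 0 ≠ 0) :
    ∃ (z₁ z₂ z₃ z₄ z₅ : V) (k l : K),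
      (∀ S : Submodule K V, z₁ ∈ S → z₂ ∈ S → z₃ ∈ S → z₄ ∈ S → z₅ ∈ S → ∀ i, u i ∈ S) ∧
      ∑ i, ∑ j, c i j • tri w a (u i) (u j) = k • tri w a z₁ z₂ + l • tri w a z₃ z₄ := by
  set d := c 0 1 - c 1 0 with hd
  have hdiv (m : K) : ∃ x, m = d * x := ⟨d⁻¹ * m, by field_simp⟩
  obtain ⟨x₂, hx₂⟩ := hdiv (c 0 2 - c 2 0)
  obtain ⟨x₃, hx₃⟩ := hdiv (c 0 3 - c 3 0)
  obtain ⟨x₄, hx₄⟩ := hdiv (c 0 4 - c 4 0)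
  obtain ⟨y₂, hy₂⟩ := hdiv (c 2 1 - c 1 2)
  obtain ⟨y₃, hy₃⟩ := hdiv (c 3 1 - c 1 3)
  obtain ⟨y₄, hy₄⟩ := hdiv (c 4 1 - c 1 4)
  obtain ⟨z₃, z₄, z₅, l, hS, hl⟩ := exists_normal_form_three w a (u 2) (u 3) (u 4)
    (c 2 3 - c 3 2 - d * (y₂ * x₃ - y₃ * x₂)) (c 2 4 - c 4 2 - d * (y₂ * x₄ - y₄ * x₂))
    (c 3 4 - c 4 3 - d * (y₃ * x₄ - y₄ * x₃))
  refine ⟨u 0 + (y₂ • u 2 + y₃ • u 3 + y₄ • u 4), u 1 + (x₂ • u 2 + x₃ • u 3 + x₄ • u 4),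
    z₃, z₄, z₅, d, l, fun S h₁ h₂ h₃ h₄ h₅ ↦ ?_, ?_⟩
  · obtain ⟨h₃, h₄, h₅⟩ := hS S h₃ h₄ h₅
    have hmem (s t r : K) : s • u 2 + t • u 3 + r • u 4 ∈ S :=
      S.add_mem (S.add_mem (S.smul_mem s h₃) (S.smul_mem t h₄)) (S.smul_mem r h₅)
    rw [S.add_mem_iff_left (hmem _ _ _)] at h₁ h₂
    intro i
    fin_cases i <;> assumption
  · rw [← hl]
    have e₁ : c 0 1 = d + c 1 0 := by rw [hd]; ring
    rw [sub_eq_iff_eq_add] at hx₂ hx₃ hx₄ hy₂ hy₃ hy₄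
    simp only [Fin.sum_univ_five]
    rw [hx₂, hx₃, hx₄, hy₂, hy₃, hy₄, e₁]
    simp [tri_sort_right w _ u]
    module

/-- A bivector in five variables has rank at most four, in a suitable basis. -/
lemma exists_normal_form_five (w : V [⋀^Fin 3]→ₗ[K] M) (a : V) (u : Fin 5 → V)
    (c : Fin 5 → Fin 5 → K) :
    ∃ (z₁ z₂ z₃ z₄ z₅ : V) (k l : K),
      (∀ S : Submodule K V, z₁ ∈ S → z₂ ∈ S → z₃ ∈ S → z₄ ∈ S → z₅ ∈ S → ∀ i, u i ∈ S) ∧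
      ∑ i, ∑ j, c i j • tri w a (u i) (u j) = k • tri w a z₁ z₂ + l • tri w a z₃ z₄ := by
  by_cases hc : ∀ i j, c i j = c j i
  · refine ⟨u 0, u 1, u 2, u 3, u 4, 0, 0, fun S h₀ h₁ h₂ h₃ h₄ i ↦ ?_, ?_⟩
    · fin_cases i <;> assumption
    · simp [Fin.sum_univ_five, tri_sort_right w _ u, hc 1 0, hc 2 0, hc 3 0, hc 4 0, hc 2 1,
        hc 3 1, hc 4 1, hc 3 2, hc 4 2, hc 4 3]
      abel
  push Not at hc
  obtain ⟨i, j, hij⟩ := hc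
  have hσ : ∀ i j : Fin 5, i ≠ j →
      (Equiv.swap 0 i * Equiv.swap 1 (Equiv.swap 0 i j)) 0 = i ∧
      (Equiv.swap 0 i * Equiv.swap 1 (Equiv.swap 0 i j)) 1 = j := by decide
  obtain ⟨h₀, h₁⟩ := hσ i j (by rintro rfl; exact hij rfl)
  generalize Equiv.swap 0 i * Equiv.swap 1 (Equiv.swap 0 i j) = σ at h₀ h₁
  obtain ⟨z₁, z₂, z₃, z₄, z₅, k, l, hS, h⟩ := exists_normal_form_of_pivot w a (u ∘ σ)
    (fun i j ↦ c (σ i) (σ j)) (by rw [h₀, h₁]; exact sub_ne_zero.2 hij)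
  refine ⟨z₁, z₂, z₃, z₄, z₅, k, l, fun S g₁ g₂ g₃ g₄ g₅ i ↦ ?_, ?_⟩
  · simpa using hS S g₁ g₂ g₃ g₄ g₅ (σ.symm i)
  · rw [← h, ← Equiv.sum_comp σ]
    refine Finset.sum_congr rfl fun i _ ↦ ?_
    rw [← Equiv.sum_comp σ]
    rfl

lemma exists_decomposable_of_pivot (w : V [⋀^Fin 3]→ₗ[K] M) (a u₁ u₂ u₃ u₄ : V)
    (c₁₂ c₁₃ c₁₄ c₂₃ c₂₄ c₃₄ : K) (hc : c₁₂ * c₃₄ - c₁₃ * c₂₄ + c₁₄ * c₂₃ = 0) (h : c₁₂ ≠ 0) :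
    ∃ (z₁ z₂ z₃ z₄ : V) (k : K),
      (∀ S : Submodule K V, z₁ ∈ S → z₂ ∈ S → z₃ ∈ S → z₄ ∈ S →
        u₁ ∈ S ∧ u₂ ∈ S ∧ u₃ ∈ S ∧ u₄ ∈ S) ∧
      c₁₂ • tri w a u₁ u₂ + c₁₃ • tri w a u₁ u₃ + c₁₄ • tri w a u₁ u₄ + c₂₃ • tri w a u₂ u₃ +
        c₂₄ • tri w a u₂ u₄ + c₃₄ • tri w a u₃ u₄ = k • tri w a z₁ z₂ := by
  have hdiv (m : K) : ∃ x, m = c₁₂ * x := ⟨c₁₂⁻¹ * m, by field_simp⟩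
  obtain ⟨x₃, rfl⟩ := hdiv c₁₃
  obtain ⟨x₄, rfl⟩ := hdiv c₁₄
  obtain ⟨y₃, rfl⟩ := hdiv c₂₃
  obtain ⟨y₄, rfl⟩ := hdiv c₂₄
  obtain rfl : c₃₄ = c₁₂ * (x₃ * y₄ - x₄ * y₃) := by
    apply mul_left_cancel₀ h
    linear_combination hc
  refine ⟨u₁ - (y₃ • u₃ + y₄ • u₄), u₂ + (x₃ • u₃ + x₄ • u₄), u₃, u₄, c₁₂,
    fun S h₁ h₂ h₃ h₄ ↦ ⟨?_, ?_, h₃, h₄⟩, ?_⟩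
  · rwa [S.sub_mem_iff_left (S.add_mem (S.smul_mem _ h₃) (S.smul_mem _ h₄))] at h₁
  · rwa [S.add_mem_iff_left (S.add_mem (S.smul_mem _ h₃) (S.smul_mem _ h₄))] at h₂
  · simp [tri_swap_right w a u₃ u₂, tri_swap_right w a u₄ u₂, tri_swap_right w a u₄ u₃]
    module

/-- A bivector in four variables whose Pfaffian vanishes is decomposable. -/
lemma exists_decomposable_of_pfaffian (w : V [⋀^Fin 3]→ₗ[K] M) (a u₁ u₂ u₃ u₄ : V)
    (c₁₂ c₁₃ c₁₄ c₂₃ c₂₄ c₃₄ : K) (hc : c₁₂ * c₃₄ - c₁₃ * c₂₄ + c₁₄ * c₂₃ = 0) :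
    ∃ (z₁ z₂ z₃ z₄ : V) (k : K),
      (∀ S : Submodule K V, z₁ ∈ S → z₂ ∈ S → z₃ ∈ S → z₄ ∈ S →
        u₁ ∈ S ∧ u₂ ∈ S ∧ u₃ ∈ S ∧ u₄ ∈ S) ∧
      c₁₂ • tri w a u₁ u₂ + c₁₃ • tri w a u₁ u₃ + c₁₄ • tri w a u₁ u₄ + c₂₃ • tri w a u₂ u₃ +
        c₂₄ • tri w a u₂ u₄ + c₃₄ • tri w a u₃ u₄ = k • tri w a z₁ z₂ := by
  by_cases h₁₂ : c₁₂ = 0; swap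
  · exact exists_decomposable_of_pivot w a u₁ u₂ u₃ u₄ _ _ _ _ _ _ hc h₁₂
  by_cases h₁₃ : c₁₃ = 0; swap
  · obtain ⟨z₁, z₂, z₃, z₄, k, hS, h⟩ := exists_decomposable_of_pivot w a u₁ u₃ u₂ u₄
      c₁₃ c₁₂ c₁₄ (-c₂₃) c₃₄ c₂₄ (by linear_combination -hc) h₁₃
    refine ⟨z₁, z₂, z₃, z₄, k, by grind, ?_⟩
    rw [← h, tri_swap_right w a u₃ u₂]
    module
  by_cases h₁₄ : c₁₄ = 0; swap
  · obtain ⟨z₁, z₂, z₃, z₄, k, hS, h⟩ := exists_decomposable_of_pivot w a u₁ u₄ u₂ u₃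
      c₁₄ c₁₂ c₁₃ (-c₂₄) (-c₃₄) c₂₃ (by linear_combination hc) h₁₄
    refine ⟨z₁, z₂, z₃, z₄, k, by grind, ?_⟩
    rw [← h, tri_swap_right w a u₄ u₂, tri_swap_right w a u₄ u₃]
    module
  obtain ⟨z₂, z₃, z₄, k, hS, h⟩ := exists_normal_form_three w a u₂ u₃ u₄ c₂₃ c₂₄ c₃₄
  refine ⟨z₂, z₃, z₄, u₁, k, by grind, ?_⟩
  rw [← h, h₁₂, h₁₃, h₁₄]
  module

lemma exists_root_of_quadratic [IsAlgClosed K] {a : K} (b c : K) (ha : a ≠ 0) :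
    ∃ t, a * t ^ 2 + b * t + c = 0 := by
  obtain ⟨t, ht⟩ := IsAlgClosed.exists_root
    (Polynomial.C a * Polynomial.X ^ 2 + Polynomial.C b * Polynomial.X + Polynomial.C c)
    (by rw [Polynomial.degree_quadratic ha]; decide)
  exact ⟨t, by simpa [Polynomial.IsRoot] using ht⟩

lemma Spans.rankLEFour_of_normal_form [IsAlgClosed K] {w : V [⋀^Fin 3]→ₗ[K] M}
    {e a z₁ z₂ z₃ z₄ z₅ : V} (h : Spans K e a z₁ z₂ z₅ z₃ z₄) {x : M} {k l : K}
    (hx : x - (k • tri w a z₁ z₂ + l • tri w a z₃ z₄) ∈ divisible w e) : RankLEFour w x := by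
  obtain ⟨α₁, α₂, α₃, β₁, β₂, β₃, m₁₁, m₁₂, m₁₃, m₂₁, m₂₂, m₂₃, m₃₁, m₃₂, m₃₃, hx⟩ :=
    h.exists_coeffs_of_mem_divisible hx
  rw [sub_eq_iff_eq_add'] at hx
  by_cases hkl : k * l = 0
  · obtain ⟨y₁, y₂, y₃, y₄, -, s, t, -, hy⟩ := exists_normal_form_five w e ![z₁, z₂, z₃, z₄, z₅]
      ![![0, α₁, m₂₂, m₂₃, m₂₁], ![0, 0, m₃₂, m₃₃, m₃₁], ![0, 0, 0, β₁, -β₃], ![0, 0, 0, 0, β₂], 0]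
    simp [Fin.sum_univ_succ] at hy
    rcases mul_eq_zero.1 hkl with rfl | rfl
    · refine rankLEFour_of_eq (l • a) z₃ z₄
        e a (α₃ • z₁ - α₂ • z₂ + m₁₁ • z₅ + m₁₂ • z₃ + m₁₃ • z₄)
        e (s • y₁) y₂ e (t • y₃) y₄ ?_
      rw [tri_smul_mid, tri_smul_mid, add_assoc, ← hy, hx]
      simp [tri_swap_right w e z₂ a, tri_swap_right w e z₅ z₃]
      module
    · refine rankLEFour_of_eq (k • a) z₁ z₂
        e a (α₃ • z₁ - α₂ • z₂ + m₁₁ • z₅ + m₁₂ • z₃ + m₁₃ • z₄)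
        e (s • y₁) y₂ e (t • y₃) y₄ ?_
      rw [tri_smul_mid, tri_smul_mid, add_assoc, ← hy, hx]
      simp [tri_swap_right w e z₂ a, tri_swap_right w e z₅ z₃]
      module
  · obtain ⟨t, ht⟩ := exists_root_of_quadratic (-α₁ * l - k * β₁)
      (α₁ * β₁ - m₂₂ * m₃₃ + m₂₃ * m₃₂) hkl
    obtain ⟨p, q, -, -, s, -, hpq⟩ := exists_decomposable_of_pfaffian w e z₁ z₂ z₃ z₄
      (α₁ - t * k) m₂₂ m₂₃ m₃₂ m₃₃ (β₁ - t * l) (by linear_combination ht)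
    obtain ⟨hk, hl⟩ := mul_ne_zero_iff.1 hkl
    obtain ⟨α₂, rfl⟩ : ∃ r, α₂ = k * r := ⟨k⁻¹ * α₂, by field_simp⟩
    obtain ⟨α₃, rfl⟩ : ∃ r, α₃ = k * r := ⟨k⁻¹ * α₃, by field_simp⟩
    obtain ⟨m₁₂, rfl⟩ : ∃ r, m₁₂ = l * r := ⟨l⁻¹ * m₁₂, by field_simp⟩
    obtain ⟨m₁₃, rfl⟩ : ∃ r, m₁₃ = l * r := ⟨l⁻¹ * m₁₃, by field_simp⟩
    refine rankLEFour_of_eq (k • (a + t • e)) (z₁ + α₂ • e) (z₂ + α₃ • e)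
      (l • (a + t • e)) (z₃ - m₁₃ • e) (z₄ + m₁₂ • e)
      e (m₁₁ • a + m₂₁ • z₁ + m₃₁ • z₂ - β₃ • z₃ + β₂ • z₄) z₅ e (s • p) q ?_
    rw [tri_smul_mid w p e q, ← hpq, hx]
    obtain ⟨v, rfl, rfl, rfl, rfl, rfl, rfl, rfl⟩ := exists_family e a z₁ z₂ z₃ z₄ z₅
    simp [tri_sort_left w _ v, tri_sort_right w _ v]
    module

/-- A trivector in the ideal generated by two vectors. -/
lemma Spans.rankLEFour_of_mem_divisible [IsAlgClosed K] {w : V [⋀^Fin 3]→ₗ[K] M}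
    {e a u₁ u₂ u₃ u₄ u₅ : V} (h : Spans K e a u₁ u₂ u₃ u₄ u₅) {x y : M} (hy : y ∈ divisible w a)
    (hx : x - y ∈ divisible w e) : RankLEFour w x := by
  have h' : Spans K a e u₁ u₂ u₃ u₄ u₅ := fun S h₁ h₂ ↦ h S h₂ h₁
  obtain ⟨α₁, α₂, α₃, β₁, β₂, β₃, m₁₁, m₁₂, m₁₃, m₂₁, m₂₂, m₂₃, m₃₁, m₃₂, m₃₃, rfl⟩ :=
    h'.exists_coeffs_of_mem_divisible hy
  obtain ⟨z₁, z₂, z₃, z₄, z₅, k, l, hS, hz⟩ := exists_normal_form_five w a ![u₁, u₂, u₃, u₄, u₅]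
    ![![0, α₁, m₂₁, m₂₂, m₂₃], ![0, 0, m₃₁, m₃₂, m₃₃], ![0, 0, 0, β₃, -β₂], ![0, 0, 0, 0, β₁], 0]
  have hz' : Spans K e a z₁ z₂ z₅ z₃ z₄ := fun S h₁ h₂ h₃ h₄ h₅ h₆ h₇ ↦
    have hu := hS S h₃ h₄ h₆ h₇ h₅
    h S h₁ h₂ (hu 0) (hu 1) (hu 2) (hu 3) (hu 4)
  refine hz'.rankLEFour_of_normal_form (w := w) (k := k) (l := l) ?_
  rw [← hz]
  rw [mem_iff_mkQ_eq_zero] at hx ⊢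
  rw [← hx]
  simp [Fin.sum_univ_succ, -Submodule.mkQ_apply, mkQ_tri, tri_swap_right _ a u₅ u₃]
  abel

lemma Spans.rankLEFour_of_congr_pivot {w : V [⋀^Fin 3]→ₗ[K] M} {e a d f b₁ b₂ b₃ : V}
    (h : Spans K e a d f b₁ b₂ b₃) {x : M} {k β₁ β₂ β₃ p₁ p₂ p₃ q₁ q₂ q₃ : K} (hk : k ≠ 0)
    (hx : x - (k • tri w a d f + β₁ • tri w a b₂ b₃ + β₂ • tri w a b₃ b₁ + β₃ • tri w a b₁ b₂
      + tri w a d (p₁ • b₁ + p₂ • b₂ + p₃ • b₃) + tri w a f (q₁ • b₁ + q₂ • b₂ + q₃ • b₃)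
      + tri w b₁ b₂ b₃) ∈ divisible w e) : RankLEFour w x := by
  have hdiv (m : K) : ∃ x, m = k * x := ⟨k⁻¹ * m, by field_simp⟩
  obtain ⟨p₁, rfl⟩ := hdiv p₁
  obtain ⟨p₂, rfl⟩ := hdiv p₂
  obtain ⟨p₃, rfl⟩ := hdiv p₃
  obtain ⟨q₁, rfl⟩ := hdiv q₁
  obtain ⟨q₂, rfl⟩ := hdiv q₂
  obtain ⟨q₃, rfl⟩ := hdiv q₃
  have h' : Spans K e (k • a) (d - (q₁ • b₁ + q₂ • b₂ + q₃ • b₃))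
      (f + (p₁ • b₁ + p₂ • b₂ + p₃ • b₃)) (b₁ + (β₁ + k * (q₂ * p₃ - q₃ * p₂)) • a)
      (b₂ + (β₂ + k * (q₃ * p₁ - q₁ * p₃)) • a) (b₃ + (β₃ + k * (q₁ * p₂ - q₂ * p₁)) • a) := by
    intro S he ha hd hf h₁ h₂ h₃
    rw [S.smul_mem_iff hk] at ha
    rw [S.add_mem_iff_left (S.smul_mem _ ha)] at h₁ h₂ h₃
    have hmem (r s t : K) : r • b₁ + s • b₂ + t • b₃ ∈ S :=
      S.add_mem (S.add_mem (S.smul_mem r h₁) (S.smul_mem s h₂)) (S.smul_mem t h₃)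
    rw [S.sub_mem_iff_left (hmem _ _ _)] at hd
    rw [S.add_mem_iff_left (hmem _ _ _)] at hf
    exact h S he ha hd hf h₁ h₂ h₃
  refine h'.rankLEFour_of_split (w := w) ?_
  convert hx using 2
  obtain ⟨v, rfl, rfl, rfl, rfl, rfl, rfl, rfl⟩ := exists_family e a d f b₁ b₂ b₃
  simp [tri_sort_left w _ v, tri_sort_right w _ v]
  module

lemma Spans.rankLEFour_of_tangent_pivot {w : V [⋀^Fin 3]→ₗ[K] M} {e a₁ a₂ a₃ b₁ b₂ b₃ : V}
    (h : Spans K e a₁ a₂ a₃ b₁ b₂ b₃) {x : M}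
    {α₁ α₂ α₃ β₁ β₂ β₃ m₁₁ m₁₂ m₁₃ m₂₁ m₂₂ m₂₃ m₃₁ m₃₂ m₃₃ : K} (hβ : β₁ ≠ 0)
    (hx : x = tri w a₁ a₂ b₃ + tri w a₂ a₃ b₁ + tri w a₃ a₁ b₂ +
      ((α₁ • tri w e a₂ a₃ + α₂ • tri w e a₃ a₁ + α₃ • tri w e a₁ a₂)
      + (β₁ • tri w e b₂ b₃ + β₂ • tri w e b₃ b₁ + β₃ • tri w e b₁ b₂)
      + (m₁₁ • tri w e a₁ b₁ + m₁₂ • tri w e a₁ b₂ + m₁₃ • tri w e a₁ b₃)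
      + (m₂₁ • tri w e a₂ b₁ + m₂₂ • tri w e a₂ b₂ + m₂₃ • tri w e a₂ b₃)
      + (m₃₁ • tri w e a₃ b₁ + m₃₂ • tri w e a₃ b₂ + m₃₃ • tri w e a₃ b₃))) :
    RankLEFour w x := by
  have h' : Spans K a₁ e b₂ b₃ a₂ a₃ b₁ := fun S h₁ h₂ h₃ h₄ h₅ h₆ h₇ ↦ h S h₂ h₁ h₅ h₆ h₇ h₃ h₄
  refine h'.rankLEFour_of_congr_pivot (w := w) hβ (β₁ := m₃₁) (β₂ := -m₂₁) (β₃ := α₁)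
    (p₁ := -m₂₂) (p₂ := -m₃₂) (p₃ := -β₃) (q₁ := -m₂₃) (q₂ := -m₃₃) (q₃ := β₂) ?_
  rw [mem_iff_mkQ_eq_zero, hx]
  obtain ⟨v, rfl, rfl, rfl, rfl, rfl, rfl, rfl⟩ := exists_family e a₁ a₂ a₃ b₁ b₂ b₃
  simp [-Submodule.mkQ_apply, mkQ_tri, tri_sort_left _ _ v, tri_sort_right _ _ v]
  abel

lemma Spans.rankLEFour_of_tangent_of_minor [IsAlgClosed K] {w : V [⋀^Fin 3]→ₗ[K] M}
    {e a₁ a₂ a₃ b₁ b₂ b₃ : V} (h : Spans K e a₁ a₂ a₃ b₁ b₂ b₃) {x : M}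
    {α₁ α₂ α₃ m₁₁ m₁₂ m₁₃ m₂₁ m₂₂ m₂₃ m₃₁ m₃₂ m₃₃ : K} (hm : m₂₂ * m₃₃ = m₂₃ * m₃₂)
    (hx : x = tri w a₁ a₂ b₃ + tri w a₂ a₃ b₁ + tri w a₃ a₁ b₂ +
      ((α₁ • tri w e a₂ a₃ + α₂ • tri w e a₃ a₁ + α₃ • tri w e a₁ a₂)
      + (m₁₁ • tri w e a₁ b₁ + m₁₂ • tri w e a₁ b₂ + m₁₃ • tri w e a₁ b₃)
      + (m₂₁ • tri w e a₂ b₁ + m₂₂ • tri w e a₂ b₂ + m₂₃ • tri w e a₂ b₃)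
      + (m₃₁ • tri w e a₃ b₁ + m₃₂ • tri w e a₃ b₂ + m₃₃ • tri w e a₃ b₃))) :
    RankLEFour w x := by
  by_cases hm' : m₂₂ = 0 ∧ m₂₃ = 0
  · obtain ⟨rfl, rfl⟩ := hm'
    have h' : Spans K a₁ (a₃ - m₂₁ • e) a₂ e b₁ b₂ b₃ := by
      intro S h₁ h₃ h₂ h₀ h₄ h₅ h₆
      rw [S.sub_mem_iff_left (S.smul_mem _ h₀)] at h₃
      exact h S h₀ h₁ h₂ h₃ h₄ h₅ h₆
    refine h'.rankLEFour_of_mem_divisible (w := w)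
      (y := tri w (a₃ - m₂₁ • e) (m₃₂ • b₂ + m₃₃ • b₃) e
        + tri w (a₃ - m₂₁ • e) (b₁ + α₁ • e) (a₂ + m₃₁ • e))
      (add_mem (tri_mem_divisible _ _ _ _) (tri_mem_divisible _ _ _ _)) ?_
    rw [mem_iff_mkQ_eq_zero, hx]
    obtain ⟨v, rfl, rfl, rfl, rfl, rfl, rfl, rfl⟩ := exists_family e a₁ a₂ a₃ b₁ b₂ b₃
    simp [-Submodule.mkQ_apply, mkQ_tri, tri_sort_left _ _ v, tri_sort_right _ _ v]
    abel
  · obtain ⟨t, rfl, rfl⟩ : ∃ t, m₃₂ = t * m₂₂ ∧ m₃₃ = t * m₂₃ := by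
      by_cases h₂ : m₂₂ = 0
      · have h₃ : m₂₃ ≠ 0 := fun h₃ ↦ hm' ⟨h₂, h₃⟩
        refine ⟨m₃₃ / m₂₃, ?_, by field_simp⟩
        field_simp
        linear_combination -hm
      · refine ⟨m₃₂ / m₂₂, by field_simp, ?_⟩
        field_simp
        linear_combination hm
    have h' : Spans K a₁ (a₂ + m₃₁ • e + t • (a₃ - m₂₁ • e)) a₃ e b₁ b₂ b₃ := by
      intro S h₁ h₂ h₃ h₀ h₄ h₅ h₆
      rw [S.add_mem_iff_left (S.smul_mem _ (S.sub_mem h₃ (S.smul_mem _ h₀))),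
        S.add_mem_iff_left (S.smul_mem _ h₀)] at h₂
      exact h S h₀ h₁ h₂ h₃ h₄ h₅ h₆
    refine h'.rankLEFour_of_mem_divisible (w := w)
      (y := tri w (a₂ + m₃₁ • e + t • (a₃ - m₂₁ • e)) (m₂₂ • b₂ + m₂₃ • b₃) e
        + tri w (a₂ + m₃₁ • e + t • (a₃ - m₂₁ • e)) (a₃ - m₂₁ • e) (b₁ + α₁ • e))
      (add_mem (tri_mem_divisible _ _ _ _) (tri_mem_divisible _ _ _ _)) ?_
    rw [mem_iff_mkQ_eq_zero, hx]
    obtain ⟨v, rfl, rfl, rfl, rfl, rfl, rfl, rfl⟩ := exists_family e a₁ a₂ a₃ b₁ b₂ b₃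
    simp [-Submodule.mkQ_apply, mkQ_tri, tri_sort_left _ _ v, tri_sort_right _ _ v]
    module

/-- A trivector congruent to a tangent vector of the Grassmannian modulo `e`. -/
lemma Spans.rankLEFour_of_tangent [IsAlgClosed K] {w : V [⋀^Fin 3]→ₗ[K] M}
    {e a₁ a₂ a₃ b₁ b₂ b₃ : V} (h : Spans K e a₁ a₂ a₃ b₁ b₂ b₃) {x : M}
    (hx : x - (tri w a₁ a₂ b₃ + tri w a₂ a₃ b₁ + tri w a₃ a₁ b₂) ∈ divisible w e) :
    RankLEFour w x := by
  obtain ⟨α₁, α₂, α₃, β₁, β₂, β₃, m₁₁, m₁₂, m₁₃, m₂₁, m₂₂, m₂₃, m₃₁, m₃₂, m₃₃, hx⟩ :=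
    h.exists_coeffs_of_mem_divisible hx
  rw [sub_eq_iff_eq_add'] at hx
  have h₁ : Spans K e a₂ a₃ a₁ b₂ b₃ b₁ := fun S h₀ h₁ h₂ h₃ h₄ h₅ h₆ ↦ h S h₀ h₃ h₁ h₂ h₆ h₄ h₅
  have h₂ : Spans K e a₃ a₁ a₂ b₃ b₁ b₂ := fun S h₀ h₁ h₂ h₃ h₄ h₅ h₆ ↦ h S h₀ h₂ h₃ h₁ h₅ h₆ h₄
  by_cases hβ₁ : β₁ = 0; swap
  · exact h.rankLEFour_of_tangent_pivot hβ₁ hx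
  by_cases hβ₂ : β₂ = 0; swap
  · exact h₁.rankLEFour_of_tangent_pivot hβ₂ (α₁ := α₂) (α₂ := α₃) (α₃ := α₁) (β₂ := β₃) (β₃ := β₁)
      (m₁₁ := m₂₂) (m₁₂ := m₂₃) (m₁₃ := m₂₁) (m₂₁ := m₃₂) (m₂₂ := m₃₃) (m₂₃ := m₃₁)
      (m₃₁ := m₁₂) (m₃₂ := m₁₃) (m₃₃ := m₁₁) (by rw [hx]; abel)
  by_cases hβ₃ : β₃ = 0; swap
  · exact h₂.rankLEFour_of_tangent_pivot hβ₃ (α₁ := α₃) (α₂ := α₁) (α₃ := α₂) (β₂ := β₁) (β₃ := β₂)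
      (m₁₁ := m₃₃) (m₁₂ := m₃₁) (m₁₃ := m₃₂) (m₂₁ := m₁₃) (m₂₂ := m₁₁) (m₂₃ := m₁₂)
      (m₃₁ := m₂₃) (m₃₂ := m₂₁) (m₃₃ := m₂₂) (by rw [hx]; abel)
  subst hβ₁ hβ₂ hβ₃
  by_cases hm : m₁₁ * m₃₃ - m₁₃ * m₃₁ = 0
  · exact h₁.rankLEFour_of_tangent_of_minor (w := w) (α₁ := α₂) (α₂ := α₃) (α₃ := α₁)
      (m₁₁ := m₂₂) (m₁₂ := m₂₃) (m₁₃ := m₂₁) (m₂₁ := m₃₂) (m₂₂ := m₃₃) (m₂₃ := m₃₁)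
      (m₃₁ := m₁₂) (m₃₂ := m₁₃) (m₃₃ := m₁₁) (by linear_combination hm)
      (by rw [hx]; simp only [zero_smul]; abel)
  obtain ⟨t, ht⟩ := exists_root_of_quadratic (-(m₁₂ + m₂₁) * m₃₃ + m₁₃ * m₃₂ + m₂₃ * m₃₁)
    (m₂₂ * m₃₃ - m₂₃ * m₃₂) hm
  have h' : Spans K e (a₁ + t • a₂) a₂ a₃ (b₁ + t • b₂) b₂ b₃ := by
    intro S h₀ h₁ h₂ h₃ h₄ h₅ h₆
    rw [S.add_mem_iff_left (S.smul_mem _ h₂)] at h₁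
    rw [S.add_mem_iff_left (S.smul_mem _ h₅)] at h₄
    exact h S h₀ h₁ h₂ h₃ h₄ h₅ h₆
  refine h'.rankLEFour_of_tangent_of_minor (w := w) (α₁ := α₁ + t * α₂) (α₂ := α₂) (α₃ := α₃)
    (m₁₁ := m₁₁) (m₁₂ := m₁₂ - t * m₁₁) (m₁₃ := m₁₃)
    (m₂₁ := m₂₁ - t * m₁₁) (m₂₂ := m₂₂ - t * m₁₂ - t * m₂₁ + t ^ 2 * m₁₁) (m₂₃ := m₂₃ - t * m₁₃)
    (m₃₁ := m₃₁) (m₃₂ := m₃₂ - t * m₃₁) (m₃₃ := m₃₃) (by linear_combination ht) ?_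
  rw [hx]
  obtain ⟨v, rfl, rfl, rfl, rfl, rfl, rfl, rfl⟩ := exists_family e a₁ a₂ a₃ b₁ b₂ b₃
  simp [tri_sort_left w _ v, tri_sort_right w _ v]
  module

lemma Spans.rankLEFour_of_common_factor [IsAlgClosed K] {w : V [⋀^Fin 3]→ₗ[K] M}
    {e a d f p b c : V} (h : Spans K e a d f p b c) {x : M} {s t : K}
    (hx : x - (tri w a d p + tri w a f (s • b + t • c) + tri w p b c) ∈ divisible w e) :
    RankLEFour w x := by
  by_cases hs : s = 0; swap
  · obtain ⟨c, rfl⟩ : ∃ c', c = s • c' := ⟨s⁻¹ • c, (smul_inv_smul₀ hs c).symm⟩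
    have h' : Spans K e a p (s • b + t • s • c) c f (-d) := by
      intro S h₀ h₁ h₂ h₃ h₄ h₅ h₆
      rw [S.add_mem_iff_left (S.smul_mem _ (S.smul_mem _ h₄)), S.smul_mem_iff hs] at h₃
      exact h S h₀ h₁ (S.neg_mem_iff.1 h₆) h₅ h₂ h₃ (S.smul_mem _ h₄)
    refine h'.rankLEFour_of_tangent (w := w) ?_
    convert hx using 2
    obtain ⟨v, rfl, rfl, rfl, rfl, rfl, rfl, rfl⟩ := exists_family e a d f p b c
    simp [tri_sort_left w _ v, tri_sort_right w _ v]
    module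
  subst hs
  by_cases ht : t = 0; swap
  · obtain ⟨b, rfl⟩ : ∃ b', b = t • b' := ⟨t⁻¹ • b, (smul_inv_smul₀ ht b).symm⟩
    have h' : Spans K e a p (t • c) (-b) f (-d) := by
      intro S h₀ h₁ h₂ h₃ h₄ h₅ h₆
      rw [S.neg_mem_iff] at h₄ h₆
      exact h S h₀ h₁ h₆ h₅ h₂ (S.smul_mem _ h₄) ((S.smul_mem_iff ht).1 h₃)
    refine h'.rankLEFour_of_tangent (w := w) ?_
    convert hx using 2
    obtain ⟨v, rfl, rfl, rfl, rfl, rfl, rfl, rfl⟩ := exists_family e a d f p b c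
    simp [tri_sort_left w _ v, tri_sort_right w _ v]
    module
  subst ht
  have h' : Spans K e p a d f b c := fun S h₀ h₁ h₂ h₃ h₄ ↦ h S h₀ h₂ h₃ h₄ h₁
  refine h'.rankLEFour_of_mem_divisible (w := w) (y := tri w p a d + tri w p b c)
    (add_mem (tri_mem_divisible _ _ _ _) (tri_mem_divisible _ _ _ _)) ?_
  convert hx using 2
  simp [tri_rotate w p a d]

lemma Spans.rankLEFour_of_congr_of_ne_zero [IsAlgClosed K] {w : V [⋀^Fin 3]→ₗ[K] M}
    {e a d f u b c : V} (h : Spans K e a d f u b c) {x : M} {p₁ p₂ p₃ q₁ q₂ q₃ : K} (hp : p₁ ≠ 0)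
    (hx : x - (tri w a d (p₁ • u + p₂ • b + p₃ • c) + tri w a f (q₁ • u + q₂ • b + q₃ • c)
      + tri w u b c) ∈ divisible w e) : RankLEFour w x := by
  obtain ⟨b, rfl⟩ : ∃ b', b = p₁ • b' := ⟨p₁⁻¹ • b, (smul_inv_smul₀ hp b).symm⟩
  obtain ⟨s, rfl⟩ : ∃ s, q₁ = s * p₁ := ⟨q₁ / p₁, by field_simp⟩
  have h' : Spans K e a (d + s • f) f (p₁ • u + (p₂ • p₁ • b + p₃ • c)) b c := by
    intro S h₀ h₁ h₂ h₃ h₄ h₅ h₆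
    have hb := S.smul_mem p₁ h₅
    rw [S.add_mem_iff_left (S.add_mem (S.smul_mem _ hb) (S.smul_mem _ h₆)),
      S.smul_mem_iff hp] at h₄
    rw [S.add_mem_iff_left (S.smul_mem _ h₃)] at h₂
    exact h S h₀ h₁ h₂ h₃ h₄ hb h₆
  refine h'.rankLEFour_of_common_factor (w := w) (s := p₁ * (q₂ - s * p₂)) (t := q₃ - s * p₃) ?_
  convert hx using 2
  obtain ⟨v, rfl, rfl, rfl, rfl, rfl, rfl, rfl⟩ := exists_family e a d f u b c
  simp
  module

lemma Spans.rankLEFour_of_congr_left [IsAlgClosed K] {w : V [⋀^Fin 3]→ₗ[K] M}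
    {e a d f u b c : V} (h : Spans K e a d f u b c) {x : M} {p₁ p₂ p₃ q₁ q₂ q₃ : K}
    (hp : p₁ ≠ 0 ∨ p₂ ≠ 0 ∨ p₃ ≠ 0)
    (hx : x - (tri w a d (p₁ • u + p₂ • b + p₃ • c) + tri w a f (q₁ • u + q₂ • b + q₃ • c)
      + tri w u b c) ∈ divisible w e) : RankLEFour w x := by
  rcases hp with hp | hp | hp
  · exact h.rankLEFour_of_congr_of_ne_zero hp hx
  · have h' : Spans K e a d f b c u := fun S h₀ h₁ h₂ h₃ h₄ h₅ h₆ ↦ h S h₀ h₁ h₂ h₃ h₆ h₄ h₅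
    refine h'.rankLEFour_of_congr_of_ne_zero (w := w) hp (p₂ := p₃) (p₃ := p₁)
      (q₁ := q₂) (q₂ := q₃) (q₃ := q₁) ?_
    convert hx using 2
    rw [tri_rotate w u b c]
    simp only [tri_add_right]
    abel
  · have h' : Spans K e a d f c u b := fun S h₀ h₁ h₂ h₃ h₄ h₅ h₆ ↦ h S h₀ h₁ h₂ h₃ h₅ h₆ h₄
    refine h'.rankLEFour_of_congr_of_ne_zero (w := w) hp (p₂ := p₁) (p₃ := p₂)
      (q₁ := q₃) (q₂ := q₁) (q₃ := q₂) ?_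
    convert hx using 2
    rw [tri_rotate w c u b]
    simp only [tri_add_right]
    abel

/-- A trivector which becomes decomposable modulo `e` and `a`. -/
lemma Spans.rankLEFour_of_congr_tri [IsAlgClosed K] {w : V [⋀^Fin 3]→ₗ[K] M}
    {e a d f u b c : V} (h : Spans K e a d f u b c) {x y : M} (hy : y ∈ divisible w a)
    (hx : x - (y + tri w u b c) ∈ divisible w e) : RankLEFour w x := by
  have h' : Spans K a e d f u b c := fun S h₁ h₂ ↦ h S h₂ h₁
  obtain ⟨α₁, α₂, α₃, β₁, β₂, β₃, m₁₁, m₁₂, m₁₃, p₁, p₂, p₃, q₁, q₂, q₃, rfl⟩ :=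
    h'.exists_coeffs_of_mem_divisible hy
  have hx' : x - (α₁ • tri w a d f + β₁ • tri w a b c + β₂ • tri w a c u + β₃ • tri w a u b
      + tri w a d (p₁ • u + p₂ • b + p₃ • c) + tri w a f (q₁ • u + q₂ • b + q₃ • c)
      + tri w u b c) ∈ divisible w e := by
    rw [mem_iff_mkQ_eq_zero] at hx ⊢
    rw [← hx]
    simp [-Submodule.mkQ_apply, mkQ_tri]
    abel
  by_cases hα : α₁ = 0; swap
  · exact h.rankLEFour_of_congr_pivot hα hx'
  subst hα
  have h₁ : Spans K e a d f (u + β₁ • a) (b + β₂ • a) (c + β₃ • a) := by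
    intro S h₀ h₁ h₂ h₃ h₄ h₅ h₆
    rw [S.add_mem_iff_left (S.smul_mem _ h₁)] at h₄ h₅ h₆
    exact h S h₀ h₁ h₂ h₃ h₄ h₅ h₆
  have hx₁ : x - (tri w a d (p₁ • (u + β₁ • a) + p₂ • (b + β₂ • a) + p₃ • (c + β₃ • a))
      + tri w a f (q₁ • (u + β₁ • a) + q₂ • (b + β₂ • a) + q₃ • (c + β₃ • a))
      + tri w (u + β₁ • a) (b + β₂ • a) (c + β₃ • a)) ∈ divisible w e := by
    convert hx' using 2
    obtain ⟨v, rfl, rfl, rfl, rfl, rfl, rfl, rfl⟩ := exists_family e a d f u b c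
    simp [tri_sort_left w _ v, tri_sort_right w _ v]
    module
  by_cases hp : p₁ ≠ 0 ∨ p₂ ≠ 0 ∨ p₃ ≠ 0
  · exact h₁.rankLEFour_of_congr_left hp hx₁
  by_cases hq : q₁ ≠ 0 ∨ q₂ ≠ 0 ∨ q₃ ≠ 0
  · have h₂ : Spans K e a f d (u + β₁ • a) (b + β₂ • a) (c + β₃ • a) :=
      fun S h₀ ha hf hd ↦ h₁ S h₀ ha hd hf
    refine h₂.rankLEFour_of_congr_left hq (q₁ := p₁) (q₂ := p₂) (q₃ := p₃) ?_
    rwa [add_comm (tri w a f _)]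
  push Not at hp hq
  obtain ⟨rfl, rfl, rfl⟩ := hp
  obtain ⟨rfl, rfl, rfl⟩ := hq
  have h₂ : Spans K e (u + β₁ • a) a d f (b + β₂ • a) (c + β₃ • a) :=
    fun S h₀ hu ha hd hf ↦ h₁ S h₀ ha hd hf hu
  refine h₂.rankLEFour_of_mem_divisible (tri_mem_divisible w _ (b + β₂ • a) (c + β₃ • a)) ?_
  simpa using hx₁

lemma Spans.rankLEFour_of_congr_smul_tri [IsAlgClosed K] {w : V [⋀^Fin 3]→ₗ[K] M}
    {e a d f u b c : V} (h : Spans K e a d f u b c) {x y : M} {k : K} (hy : y ∈ divisible w a)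
    (hx : x - (y + k • tri w u b c) ∈ divisible w e) : RankLEFour w x := by
  by_cases hk : k = 0
  · exact h.rankLEFour_of_mem_divisible hy (by simpa [hk] using hx)
  · have h' : Spans K e a d f (k • u) b c :=
      fun S h₀ h₁ h₂ h₃ h₄ ↦ h S h₀ h₁ h₂ h₃ ((S.smul_mem_iff hk).1 h₄)
    exact h'.rankLEFour_of_congr_tri hy (by rwa [tri_smul_left])

/-- A trivector in the ideal generated by three vectors. -/
lemma Spans.rankLEFour_of_mem_divisible_add [IsAlgClosed K] {w : V [⋀^Fin 3]→ₗ[K] M}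
    {e a u f₁ f₂ f₃ f₄ : V} (h : Spans K e a u f₁ f₂ f₃ f₄) {x y z : M} (hy : y ∈ divisible w a)
    (hz : z ∈ divisible w u) (hx : x - (y + z) ∈ divisible w e) : RankLEFour w x := by
  have h₁ : Spans K a e u f₁ f₂ f₃ f₄ := fun S h₁ h₂ ↦ h S h₂ h₁
  have h₂ : Spans K u e a f₁ f₂ f₃ f₄ := fun S h₁ h₂ h₃ ↦ h S h₂ h₃ h₁
  obtain ⟨α₁, α₂, α₃, β₁, β₂, β₃, m₁₁, m₁₂, m₁₃, m₂₁, m₂₂, m₂₃, m₃₁, m₃₂, m₃₃, hy'⟩ :=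
    h₁.exists_coeffs_of_mem_divisible hy
  obtain ⟨γ₁, γ₂, γ₃, δ₁, δ₂, δ₃, n₁₁, n₁₂, n₁₃, n₂₁, n₂₂, n₂₃, n₃₁, n₃₂, n₃₃, hz'⟩ :=
    h₂.exists_coeffs_of_mem_divisible hz
  by_cases hpf : m₃₁ * β₁ + m₃₂ * β₂ + m₃₃ * β₃ = 0
  · obtain ⟨z₁, z₂, z₃, z₄, k, hS, hk⟩ := exists_decomposable_of_pfaffian w a f₁ f₂ f₃ f₄
      m₃₁ m₃₂ m₃₃ β₃ (-β₂) β₁ (by linear_combination hpf)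
    have h' : Spans K e u z₃ z₄ a z₁ z₂ := by
      intro S h₀ h₁ h₂ h₃ h₄ h₅ h₆
      obtain ⟨g₁, g₂, g₃, g₄⟩ := hS S h₅ h₆ h₂ h₃
      exact h S h₀ h₄ h₁ g₁ g₂ g₃ g₄
    refine h'.rankLEFour_of_congr_smul_tri (w := w) (k := k)
      (y := z + tri w u (α₁ • f₁ + m₂₁ • f₂ + m₂₂ • f₃ + m₂₃ • f₄) a)
      (add_mem hz (tri_mem_divisible _ _ _ _)) ?_
    rw [← hk]
    rw [mem_iff_mkQ_eq_zero] at hx ⊢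
    rw [← hx, hy']
    obtain ⟨v, rfl, rfl, rfl, rfl, rfl, rfl, rfl⟩ := exists_family e a u f₁ f₂ f₃ f₄
    simp [-Submodule.mkQ_apply, mkQ_tri, tri_sort_left _ _ v, tri_sort_right _ _ v]
    abel
  · obtain ⟨t, ht⟩ := exists_root_of_quadratic
      (n₃₁ * β₁ + n₃₂ * β₂ + n₃₃ * β₃ + m₃₁ * δ₁ + m₃₂ * δ₂ + m₃₃ * δ₃)
      (n₃₁ * δ₁ + n₃₂ * δ₂ + n₃₃ * δ₃) hpf
    obtain ⟨z₁, z₂, z₃, z₄, k, hS, hk⟩ := exists_decomposable_of_pfaffian w u f₁ f₂ f₃ f₄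
      (n₃₁ + t * m₃₁) (n₃₂ + t * m₃₂) (n₃₃ + t * m₃₃) (δ₃ + t * β₃) (-(δ₂ + t * β₂)) (δ₁ + t * β₁)
      (by linear_combination ht)
    have h' : Spans K e (a - t • u) z₃ z₄ u z₁ z₂ := by
      intro S h₀ h₁ h₂ h₃ h₄ h₅ h₆
      obtain ⟨g₁, g₂, g₃, g₄⟩ := hS S h₅ h₆ h₂ h₃
      rw [S.sub_mem_iff_left (S.smul_mem _ h₄)] at h₁
      exact h S h₀ h₁ h₄ g₁ g₂ g₃ g₄
    refine h'.rankLEFour_of_congr_smul_tri (w := w) (k := k)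
      (y := tri w (a - t • u) u
          ((α₁ - γ₁) • f₁ + (m₂₁ - n₂₁) • f₂ + (m₂₂ - n₂₂) • f₃ + (m₂₃ - n₂₃) • f₄)
        + tri w (a - t • u) f₁ (m₃₁ • f₂ + m₃₂ • f₃ + m₃₃ • f₄)
        + tri w (a - t • u) f₂ (β₃ • f₃ - β₂ • f₄) + tri w (a - t • u) f₃ (β₁ • f₄))
      (add_mem (add_mem (add_mem (tri_mem_divisible _ _ _ _) (tri_mem_divisible _ _ _ _))
        (tri_mem_divisible _ _ _ _)) (tri_mem_divisible _ _ _ _)) ?_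
    rw [← hk]
    rw [mem_iff_mkQ_eq_zero] at hx ⊢
    rw [← hx, hy', hz']
    obtain ⟨v, rfl, rfl, rfl, rfl, rfl, rfl, rfl⟩ := exists_family e a u f₁ f₂ f₃ f₄
    simp [-Submodule.mkQ_apply, mkQ_tri, tri_sort_left _ _ v, tri_sort_right _ _ v]
    module

lemma Spans.rankLEFour_of_shared_vector_of_ne_zero [IsAlgClosed K] {w : V [⋀^Fin 3]→ₗ[K] M}
    {e a b c d f g : V} (h : Spans K e a b c d f g) {x y : M} {k s t r : K} (hs : s ≠ 0)
    (hy : y ∈ divisible w a)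
    (hx : x - (y + (k • tri w b c d + tri w g f (s • b + t • c + r • d))) ∈ divisible w e) :
    RankLEFour w x := by
  obtain ⟨c, rfl⟩ : ∃ c', c = s • c' := ⟨s⁻¹ • c, (smul_inv_smul₀ hs c).symm⟩
  have h' : Spans K e a (s • b + (t • s • c + r • d)) c d f g := by
    intro S h₀ h₁ h₂ h₃ h₄ h₅ h₆
    have hc := S.smul_mem s h₃
    rw [S.add_mem_iff_left (S.add_mem (S.smul_mem _ hc) (S.smul_mem _ h₄)),
      S.smul_mem_iff hs] at h₂
    exact h S h₀ h₁ h₂ hc h₄ h₅ h₆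
  refine h'.rankLEFour_of_mem_divisible_add (w := w) hy
    (z := k • tri w (s • b + (t • s • c + r • d)) c d + tri w (s • b + (t • s • c + r • d)) g f)
    (add_mem (Submodule.smul_mem _ _ (tri_mem_divisible _ _ _ _)) (tri_mem_divisible _ _ _ _)) ?_
  convert hx using 3
  obtain ⟨v, rfl, rfl, rfl, rfl, rfl, rfl, rfl⟩ := exists_family e a b c d f g
  simp [tri_sort_left w _ v, tri_sort_right w _ v]
  module

lemma Spans.rankLEFour_of_shared_vector [IsAlgClosed K] {w : V [⋀^Fin 3]→ₗ[K] M}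
    {e a b c d f g : V} (h : Spans K e a b c d f g) {x y : M} {k s t r : K}
    (hy : y ∈ divisible w a)
    (hx : x - (y + (k • tri w b c d + tri w g f (s • b + t • c + r • d))) ∈ divisible w e) :
    RankLEFour w x := by
  by_cases hs : s = 0; swap
  · exact h.rankLEFour_of_shared_vector_of_ne_zero hs hy hx
  by_cases ht : t = 0; swap
  · have h' : Spans K e a c d b f g := fun S h₀ h₁ h₂ h₃ h₄ ↦ h S h₀ h₁ h₄ h₂ h₃
    refine h'.rankLEFour_of_shared_vector_of_ne_zero ht (k := k) (t := r) (r := s) hy ?_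
    rw [tri_rotate w b c d] at hx
    convert hx using 5
    abel
  by_cases hr : r = 0; swap
  · have h' : Spans K e a d b c f g := fun S h₀ h₁ h₂ h₃ h₄ ↦ h S h₀ h₁ h₃ h₄ h₂
    refine h'.rankLEFour_of_shared_vector_of_ne_zero hr (k := k) (t := s) (r := t) hy ?_
    rw [tri_rotate w d b c]
    convert hx using 5
    abel
  subst hs ht hr
  exact h.rankLEFour_of_mem_divisible_add hy
    (Submodule.smul_mem _ k (tri_mem_divisible w b c d)) (by simpa using hx)

lemma Spans.rankLEFour_of_coeffs_of_ne_zero [IsAlgClosed K] {w : V [⋀^Fin 3]→ₗ[K] M}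
    {e a p₁ p₂ p₃ p₄ p₅ : V} (h : Spans K e a p₁ p₂ p₃ p₄ p₅) {x y : M}
    {c₁₂₃ c₁₂₄ c₁₂₅ c₁₃₄ c₁₃₅ c₁₄₅ c₂₃₄ c₂₃₅ c₂₄₅ c₃₄₅ : K} (hc : c₂₃₄ ≠ 0)
    (hy : y ∈ divisible w a)
    (hx : x - (y + (c₁₂₃ • tri w p₁ p₂ p₃ + c₁₂₄ • tri w p₁ p₂ p₄ + c₁₂₅ • tri w p₁ p₂ p₅
      + c₁₃₄ • tri w p₁ p₃ p₄ + c₁₃₅ • tri w p₁ p₃ p₅ + c₁₄₅ • tri w p₁ p₄ p₅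
      + c₂₃₄ • tri w p₂ p₃ p₄ + c₂₃₅ • tri w p₂ p₃ p₅ + c₂₄₅ • tri w p₂ p₄ p₅
      + c₃₄₅ • tri w p₃ p₄ p₅)) ∈ divisible w e) :
    RankLEFour w x := by
  have hdiv (z : K) : ∃ q, z = c₂₃₄ * q := ⟨z / c₂₃₄, by field_simp⟩
  obtain ⟨α, rfl⟩ := hdiv c₃₄₅
  obtain ⟨β, rfl⟩ := hdiv c₂₄₅
  obtain ⟨γ, rfl⟩ := hdiv c₂₃₅
  obtain ⟨α', rfl⟩ := hdiv c₁₃₄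
  obtain ⟨β', rfl⟩ := hdiv c₁₂₄
  obtain ⟨γ', rfl⟩ := hdiv c₁₂₃
  have h' : Spans K e a (p₂ + α • p₅ + α' • p₁) (p₃ - β • p₅ - β' • p₁) (p₄ + γ • p₅ + γ' • p₁)
      p₅ p₁ := by
    intro S h₀ h₁ h₂ h₃ h₄ h₅ h₆
    rw [S.add_mem_iff_left (S.smul_mem _ h₆), S.add_mem_iff_left (S.smul_mem _ h₅)] at h₂ h₄
    rw [S.sub_mem_iff_left (S.smul_mem _ h₆), S.sub_mem_iff_left (S.smul_mem _ h₅)] at h₃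
    exact h S h₀ h₁ h₆ h₂ h₃ h₄ h₅
  refine h'.rankLEFour_of_shared_vector (w := w) hy (k := c₂₃₄)
    (s := -c₁₂₅ - c₂₃₄ * (β * γ' - β' * γ)) (t := -c₁₃₅ - c₂₃₄ * (α * γ' - α' * γ))
    (r := -c₁₄₅ - c₂₃₄ * (α * β' - α' * β)) ?_
  convert hx using 3
  obtain ⟨v, rfl, rfl, rfl, rfl, rfl, rfl, rfl⟩ := exists_family e a p₁ p₂ p₃ p₄ p₅
  simp [tri_sort_left w _ v, tri_sort_right w _ v]
  module

lemma Spans.rankLEFour_of_coeffs [IsAlgClosed K] {w : V [⋀^Fin 3]→ₗ[K] M}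
    {e a p₁ p₂ p₃ p₄ p₅ : V} (h : Spans K e a p₁ p₂ p₃ p₄ p₅) {x y : M}
    {c₁₂₃ c₁₂₄ c₁₂₅ c₁₃₄ c₁₃₅ c₁₄₅ c₂₃₄ c₂₃₅ c₂₄₅ c₃₄₅ : K} (hy : y ∈ divisible w a)
    (hx : x - (y + (c₁₂₃ • tri w p₁ p₂ p₃ + c₁₂₄ • tri w p₁ p₂ p₄ + c₁₂₅ • tri w p₁ p₂ p₅
      + c₁₃₄ • tri w p₁ p₃ p₄ + c₁₃₅ • tri w p₁ p₃ p₅ + c₁₄₅ • tri w p₁ p₄ p₅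
      + c₂₃₄ • tri w p₂ p₃ p₄ + c₂₃₅ • tri w p₂ p₃ p₅ + c₂₄₅ • tri w p₂ p₄ p₅
      + c₃₄₅ • tri w p₃ p₄ p₅)) ∈ divisible w e) :
    RankLEFour w x := by
  by_cases h₁ : c₂₃₄ = 0; swap
  · exact h.rankLEFour_of_coeffs_of_ne_zero h₁ hy hx
  by_cases h₂ : c₂₃₅ = 0; swap
  · have h' : Spans K e a p₁ p₂ p₃ p₅ p₄ :=
      fun S g₀ g₁ g₂ g₃ g₄ g₅ g₆ ↦ h S g₀ g₁ g₂ g₃ g₄ g₆ g₅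
    refine h'.rankLEFour_of_coeffs_of_ne_zero (w := w) h₂ hy (c₁₂₃ := c₁₂₃) (c₁₂₄ := c₁₂₅)
      (c₁₂₅ := c₁₂₄) (c₁₃₄ := c₁₃₅) (c₁₃₅ := c₁₃₄) (c₁₄₅ := -c₁₄₅) (c₂₃₅ := c₂₃₄)
      (c₂₄₅ := -c₂₄₅) (c₃₄₅ := -c₃₄₅) ?_
    convert hx using 3
    simp only [fun q ↦ tri_swap_right w q p₅ p₄]
    module
  by_cases h₃ : c₂₄₅ = 0; swap
  · have h' : Spans K e a p₁ p₂ p₄ p₅ p₃ :=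
      fun S g₀ g₁ g₂ g₃ g₄ g₅ g₆ ↦ h S g₀ g₁ g₂ g₃ g₆ g₄ g₅
    refine h'.rankLEFour_of_coeffs_of_ne_zero (w := w) h₃ hy (c₁₂₃ := c₁₂₄) (c₁₂₄ := c₁₂₅)
      (c₁₂₅ := c₁₂₃) (c₁₃₄ := c₁₄₅) (c₁₃₅ := -c₁₃₄) (c₁₄₅ := -c₁₃₅) (c₂₃₅ := -c₂₃₄)
      (c₂₄₅ := -c₂₃₅) (c₃₄₅ := c₃₄₅) ?_
    convert hx using 3
    simp only [fun q ↦ tri_swap_right w q p₄ p₃, fun q ↦ tri_swap_right w q p₅ p₃,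
      tri_swap_left w p₄ p₃]
    module
  by_cases h₄ : c₃₄₅ = 0; swap
  · have h' : Spans K e a p₁ p₃ p₄ p₅ p₂ :=
      fun S g₀ g₁ g₂ g₃ g₄ g₅ g₆ ↦ h S g₀ g₁ g₂ g₆ g₃ g₄ g₅
    refine h'.rankLEFour_of_coeffs_of_ne_zero (w := w) h₄ hy (c₁₂₃ := c₁₃₄) (c₁₂₄ := c₁₃₅)
      (c₁₂₅ := -c₁₂₃) (c₁₃₄ := c₁₄₅) (c₁₃₅ := -c₁₂₄) (c₁₄₅ := -c₁₂₅) (c₂₃₅ := c₂₃₄)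
      (c₂₄₅ := c₂₃₅) (c₃₄₅ := c₂₄₅) ?_
    convert hx using 3
    simp only [fun q ↦ tri_swap_right w p₁ q p₂, ← tri_rotate w p₂]
    module
  subst h₁ h₂ h₃ h₄
  refine h.rankLEFour_of_mem_divisible_add (w := w) hy
    (z := tri w p₁ p₂ (c₁₂₃ • p₃ + c₁₂₄ • p₄ + c₁₂₅ • p₅) + tri w p₁ p₃ (c₁₃₄ • p₄ + c₁₃₅ • p₅)
      + tri w p₁ p₄ (c₁₄₅ • p₅))
    (add_mem (add_mem (tri_mem_divisible _ _ _ _) (tri_mem_divisible _ _ _ _))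
      (tri_mem_divisible _ _ _ _)) ?_
  convert hx using 3
  simp only [tri_add_right, tri_smul_right]
  module

lemma Spans.exists_coeffs_of_mem_span {w : V [⋀^Fin 3]→ₗ[K] M} {e a p₁ p₂ p₃ p₄ p₅ : V}
    (h : Spans K e a p₁ p₂ p₃ p₄ p₅) {x : M} (hx : x ∈ Submodule.span K (Set.range w)) :
    ∃ y ∈ divisible w a, ∃ c₁₂₃ c₁₂₄ c₁₂₅ c₁₃₄ c₁₃₅ c₁₄₅ c₂₃₄ c₂₃₅ c₂₄₅ c₃₄₅ : K,
      x - (y + (c₁₂₃ • tri w p₁ p₂ p₃ + c₁₂₄ • tri w p₁ p₂ p₄ + c₁₂₅ • tri w p₁ p₂ p₅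
      + c₁₃₄ • tri w p₁ p₃ p₄ + c₁₃₅ • tri w p₁ p₃ p₅ + c₁₄₅ • tri w p₁ p₄ p₅
      + c₂₃₄ • tri w p₂ p₃ p₄ + c₂₃₅ • tri w p₂ p₃ p₅ + c₂₄₅ • tri w p₂ p₄ p₅
      + c₃₄₅ • tri w p₃ p₄ p₅)) ∈ divisible w e := by
  induction hx using Submodule.span_induction with
  | mem x hx =>
    obtain ⟨u, rfl⟩ := hx
    have hu : w u = tri w (u 0) (u 1) (u 2) := by
      rw [tri]; congr 1; ext i; fin_cases i <;> rfl
    obtain ⟨s, hs⟩ := h.exists_coords (u 0)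
    obtain ⟨t, ht⟩ := h.exists_coords (u 1)
    obtain ⟨r, hr⟩ := h.exists_coords (u 2)
    set s' := s 2 • p₁ + s 3 • p₂ + s 4 • p₃ + s 5 • p₄ + s 6 • p₅ with hs'
    set t' := t 2 • p₁ + t 3 • p₂ + t 4 • p₃ + t 5 • p₄ + t 6 • p₅ with ht'
    set r' := r 2 • p₁ + r 3 • p₂ + r 4 • p₃ + r 5 • p₄ + r 6 • p₅ with hr'
    have hs₁ : u 0 = s 0 • e + s 1 • a + s' := by rw [hs, hs']; abel
    have ht₁ : u 1 = t 0 • e + t 1 • a + t' := by rw [ht, ht']; abel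
    have hr₁ : u 2 = r 0 • e + r 1 • a + r' := by rw [hr, hr']; abel
    let m (i j k : Fin 7) : K := s i * (t j * r k - t k * r j) - s j * (t i * r k - t k * r i)
      + s k * (t i * r j - t j * r i)
    refine ⟨tri w a (s 1 • t' - t 1 • s') r' + tri w a s' (r 1 • t'),
      add_mem (tri_mem_divisible _ _ _ _) (tri_mem_divisible _ _ _ _),
      m 2 3 4, m 2 3 5, m 2 3 6, m 2 4 5, m 2 4 6, m 2 5 6, m 3 4 5, m 3 4 6, m 3 5 6, m 4 5 6, ?_⟩
    have key : m 2 3 4 • tri w p₁ p₂ p₃ + m 2 3 5 • tri w p₁ p₂ p₄ + m 2 3 6 • tri w p₁ p₂ p₅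
        + m 2 4 5 • tri w p₁ p₃ p₄ + m 2 4 6 • tri w p₁ p₃ p₅ + m 2 5 6 • tri w p₁ p₄ p₅
        + m 3 4 5 • tri w p₂ p₃ p₄ + m 3 4 6 • tri w p₂ p₃ p₅ + m 3 5 6 • tri w p₂ p₄ p₅
        + m 4 5 6 • tri w p₃ p₄ p₅ = tri w s' t' r' := by
      rw [hs', ht', hr']
      clear_value s' t' r'
      obtain ⟨v, rfl, rfl, rfl, rfl, rfl, rfl, rfl⟩ := exists_family e a p₁ p₂ p₃ p₄ p₅
      simp [m, tri_sort_left w _ v, tri_sort_right w _ v]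
      module
    rw [key, hu, hs₁, ht₁, hr₁, mem_iff_mkQ_eq_zero]
    clear_value s' t' r'
    obtain ⟨v, rfl, rfl, rfl, rfl, rfl, -⟩ := exists_family e a s' t' r' e e
    simp [-Submodule.mkQ_apply, mkQ_tri, tri_sort_left _ _ v, tri_sort_right _ _ v]
    module
  | zero => exact ⟨0, zero_mem _, 0, 0, 0, 0, 0, 0, 0, 0, 0, 0, by simp⟩
  | add x x' _ _ hx hx' =>
    obtain ⟨y, hy, c₁, c₂, c₃, c₄, c₅, c₆, c₇, c₈, c₉, c₁₀, hx⟩ := hx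
    obtain ⟨y', hy', d₁, d₂, d₃, d₄, d₅, d₆, d₇, d₈, d₉, d₁₀, hx'⟩ := hx'
    refine ⟨y + y', add_mem hy hy', c₁ + d₁, c₂ + d₂, c₃ + d₃, c₄ + d₄, c₅ + d₅, c₆ + d₆,
      c₇ + d₇, c₈ + d₈, c₉ + d₉, c₁₀ + d₁₀, ?_⟩
    convert add_mem hx hx' using 1
    module
  | smul k x _ hx =>
    obtain ⟨y, hy, c₁, c₂, c₃, c₄, c₅, c₆, c₇, c₈, c₉, c₁₀, hx⟩ := hx
    refine ⟨k • y, Submodule.smul_mem _ k hy, k * c₁, k * c₂, k * c₃, k * c₄, k * c₅, k * c₆,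
      k * c₇, k * c₈, k * c₉, k * c₁₀, ?_⟩
    convert Submodule.smul_mem _ k hx using 1
    module

/-- Over an algebraically closed field, an alternating trilinear map on a space of dimension at
most seven has all of its span covered by sums of four values. -/
theorem Spans.rankLEFour_of_mem_span [IsAlgClosed K] {w : V [⋀^Fin 3]→ₗ[K] M}
    {e a p₁ p₂ p₃ p₄ p₅ : V} (h : Spans K e a p₁ p₂ p₃ p₄ p₅) {x : M}
    (hx : x ∈ Submodule.span K (Set.range w)) : RankLEFour w x := by
  obtain ⟨y, hy, _, _, _, _, _, _, _, _, _, _, hx⟩ := h.exists_coeffs_of_mem_span hx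
  exact h.rankLEFour_of_coeffs hy hx

lemma spans_single (K : Type*) [Field K] : Spans K (Pi.single 0 1 : Fin 7 → K) (Pi.single 1 1)
    (Pi.single 2 1) (Pi.single 3 1) (Pi.single 4 1) (Pi.single 5 1) (Pi.single 6 1) := by
  intro S h₀ h₁ h₂ h₃ h₄ h₅ h₆
  rw [eq_top_iff, ← (Pi.basisFun K (Fin 7)).span_eq, Submodule.span_le]
  rintro _ ⟨i, rfl⟩
  rw [Pi.basisFun_apply]
  fin_cases i <;> assumption

end Trivector

/-- Every trivector in `⋀³ℂ⁷` is a sum of at most `4` decomposable trivectors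
`v₀ ∧ v₁ ∧ v₂` (images of the canonical alternating map `ιMulti`). -/
theorem trivector_C7_max_rank_four (x : ⋀[ℂ]^3 (Fin 7 → ℂ)) :
    ∃ v : Fin 4 → Fin 3 → (Fin 7 → ℂ),
      (x : ExteriorAlgebra ℂ (Fin 7 → ℂ)) =
        ∑ i : Fin 4, ExteriorAlgebra.ιMulti ℂ 3 (v i) := by
  refine (Trivector.spans_single ℂ).rankLEFour_of_mem_span ?_
  rw [ExteriorAlgebra.ιMulti_span_fixedDegree]
  exact x.2
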